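/- Let X be a Rado complex with vertex set V(X) = ℕ, and suppose each vertex n ∈ ℕ is selected independently at random with probability p_n ∈ [0,1] (Bernoulli product measure on ω ∈ {0,1}^ℕ with ℙ(ω_n = 1) = p_n). Let X_ω denote the subcomplex of X induced on the set of selected vertices {n : ω_n = 1}, and set q_n = 1 − p_n. If Σ_n q_n < ∞, then with probability 1 the set of selected vertices has finite complement in ℕ and X_ω is a Rado complex. -/

import Mathlib

/-- An (abstract) simplicial complex with vertices drawn from `ℕ`:
a set of nonempty finite subsets of `ℕ` (the simplexes) closed under
passing to nonempty subsets.  The vertex set `V(X)` is the set of `v`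
with `{v}` a simplex. -/
structure SComplex where
  faces : Set (Finset ℕ)
  nonempty_of_mem : ∀ s ∈ faces, s.Nonempty
  down_closed : ∀ s ∈ faces, ∀ t ⊆ s, t.Nonempty → t ∈ faces

namespace SComplex

/-- The vertex set of a simplicial complex. -/
def vertexSet (X : SComplex) : Set ℕ := {v | {v} ∈ X.faces}

/-- The subcomplex of `X` induced on a set `U` of vertices. -/
def induced (X : SComplex) (U : Set ℕ) : SComplex where
  faces := {s | s ∈ X.faces ∧ (↑s : Set ℕ) ⊆ U}
  nonempty_of_mem := fun s hs => X.nonempty_of_mem s hs.1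
  down_closed := fun s hs t hts ht =>
    ⟨X.down_closed s hs.1 t hts ht,
     fun x hx => hs.2 (Finset.mem_coe.mpr (hts (Finset.mem_coe.mp hx)))⟩

/-- The link of a vertex `v`: all simplexes `σ` with `v ∉ σ` and `σ ∪ {v}` a simplex. -/
def link (X : SComplex) (v : ℕ) : SComplex where
  faces := {s | s ∈ X.faces ∧ v ∉ s ∧ insert v s ∈ X.faces}
  nonempty_of_mem := fun s hs => X.nonempty_of_mem s hs.1
  down_closed := fun s hs t hts ht =>
    ⟨X.down_closed s hs.1 t hts ht,
     fun hv => hs.2.1 (hts hv),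
     X.down_closed _ hs.2.2 _ (Finset.insert_subset_insert v hts)
       (Finset.insert_nonempty v t)⟩

/-- `IsIso X Y f` : the map `f` is an isomorphism of simplicial complexes from `X` to `Y`,
i.e. a bijection of the vertex sets which induces a bijection between the sets of simplexes. -/
def IsIso (X Y : SComplex) (f : ℕ → ℕ) : Prop :=
  Set.BijOn f X.vertexSet Y.vertexSet ∧
    ∀ s : Finset ℕ, (↑s : Set ℕ) ⊆ X.vertexSet → (s ∈ X.faces ↔ s.image f ∈ Y.faces)

/-- Two simplicial complexes are isomorphic. -/
def Isomorphic (X Y : SComplex) : Prop := ∃ f, IsIso X Y f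

/-- `X` is universal: every countable simplicial complex is isomorphic to an induced
subcomplex of `X`. -/
def Universal (X : SComplex) : Prop :=
  ∀ Y : SComplex, Y.vertexSet.Countable →
    ∃ U ⊆ X.vertexSet, Isomorphic Y (X.induced U)

/-- `X` is homogeneous: every isomorphism between finite induced subcomplexes of `X`
extends to an isomorphism of `X` onto itself. -/
def Homogeneous (X : SComplex) : Prop :=
  ∀ U U' : Set ℕ, U.Finite → U'.Finite → U ⊆ X.vertexSet → U' ⊆ X.vertexSet →
    ∀ f : ℕ → ℕ, IsIso (X.induced U) (X.induced U') f →
      ∃ F : ℕ → ℕ, IsIso X X F ∧ Set.EqOn F f U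

/-- A Rado complex: a countable simplicial complex which is universal and homogeneous. -/
def IsRado (X : SComplex) : Prop :=
  X.vertexSet.Countable ∧ Universal X ∧ Homogeneous X

/-- The ampleness condition: for every finite `U ⊆ V(X)` and every subcomplex `A` of the
induced complex `X_U` there is a vertex `v ∈ V(X) - U` with `Lk_X(v) ∩ X_U = A`. -/
def AmpleProp (X : SComplex) : Prop :=
  ∀ U : Set ℕ, U.Finite → U ⊆ X.vertexSet →
    ∀ A : SComplex, A.faces ⊆ (X.induced U).faces →
      ∃ v ∈ X.vertexSet \ U, (X.link v).faces ∩ (X.induced U).faces = A.faces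

/-- An ample complex: a countable simplicial complex satisfying the ampleness condition. -/
def IsAmple (X : SComplex) : Prop := X.vertexSet.Countable ∧ AmpleProp X

/-- `L'` is an induced subcomplex of `L`. -/
def IsInduced (L' L : SComplex) : Prop :=
  L'.faces ⊆ L.faces ∧ ∀ s ∈ L.faces, (↑s : Set ℕ) ⊆ L'.vertexSet → s ∈ L'.faces

end SComplex

/-- `IsBernoulli μ p` : `μ` is the Bernoulli product measure on `{0,1}^ℕ` in which
vertex `n` is selected (`ω n = true`) with probability `p n`, independently: `μ` is a
probability measure and the probability of any finite cylinder event is the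
corresponding product. -/
def IsBernoulli (μ : MeasureTheory.Measure (ℕ → Bool)) (p : ℕ → ℝ) : Prop :=
  MeasureTheory.IsProbabilityMeasure μ ∧
    ∀ (s : Finset ℕ) (b : ℕ → Bool),
      μ {ω | ∀ n ∈ s, ω n = b n} =
        ∏ n ∈ s, ENNReal.ofReal (if b n then p n else 1 - p n)

/-- The set of selected vertices of `ω`. -/
def selected (ω : ℕ → Bool) : Set ℕ := {n | ω n = true}

namespace SComplex

lemma mem_vertexSet_of_mem_face {X : SComplex} {s : Finset ℕ} (hs : s ∈ X.faces) {v : ℕ}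
    (hv : v ∈ s) : v ∈ X.vertexSet :=
  X.down_closed s hs {v} (by simpa using hv) (Finset.singleton_nonempty v)

lemma vertexSet_induced (X : SComplex) (U : Set ℕ) :
    (X.induced U).vertexSet = X.vertexSet ∩ U := by
  ext v
  simp [vertexSet, induced]

/-- The relation `R` is a partial isomorphism between the complexes `Y` and `Z`: it is the graph
of a bijection between sets of vertices which preserves and reflects simplexes. -/
structure IsPartialIso (Y Z : SComplex) (R : Set (ℕ × ℕ)) : Prop where
  mem_left : ∀ x ∈ R, x.1 ∈ Y.vertexSet
  mem_right : ∀ x ∈ R, x.2 ∈ Z.vertexSet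
  eq_iff : ∀ x ∈ R, ∀ y ∈ R, (x.1 = y.1 ↔ x.2 = y.2)
  faces_iff : ∀ t : Finset (ℕ × ℕ), (↑t : Set (ℕ × ℕ)) ⊆ R →
    (t.image Prod.fst ∈ Y.faces ↔ t.image Prod.snd ∈ Z.faces)

lemma IsPartialIso.empty (Y Z : SComplex) : IsPartialIso Y Z ∅ where
  mem_left := by simp
  mem_right := by simp
  eq_iff := by simp
  faces_iff t ht := by
    obtain rfl : t = ∅ := by simpa using ht
    have hY : ∅ ∉ Y.faces := fun h => by simpa using Y.nonempty_of_mem _ h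
    have hZ : ∅ ∉ Z.faces := fun h => by simpa using Z.nonempty_of_mem _ h
    simp [hY, hZ]

lemma IsPartialIso.swap {Y Z : SComplex} {R : Finset (ℕ × ℕ)} (h : IsPartialIso Y Z ↑R) :
    IsPartialIso Z Y ↑(R.image Prod.swap) where
  mem_left x hx := by
    obtain ⟨y, hy, rfl⟩ := Finset.mem_image.1 (Finset.mem_coe.1 hx)
    exact h.mem_right y hy
  mem_right x hx := by
    obtain ⟨y, hy, rfl⟩ := Finset.mem_image.1 (Finset.mem_coe.1 hx)
    exact h.mem_left y hy
  eq_iff x hx y hy := by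
    obtain ⟨a, ha, rfl⟩ := Finset.mem_image.1 (Finset.mem_coe.1 hx)
    obtain ⟨b, hb, rfl⟩ := Finset.mem_image.1 (Finset.mem_coe.1 hy)
    exact (h.eq_iff a ha b hb).symm
  faces_iff t ht := by
    obtain ⟨t, ht', rfl⟩ := Finset.subset_image_iff.1 (Finset.coe_subset.1 ht)
    have := h.faces_iff t ht'
    simp only [Finset.image_image]
    exact this.symm

/-- The forth step of the back-and-forth construction. -/
lemma IsPartialIso.exists_extension {Y Z : SComplex} (hZ : Z.AmpleProp) {R : Finset (ℕ × ℕ)}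
    (h : IsPartialIso Y Z ↑R) {a : ℕ} (ha : a ∈ Y.vertexSet) :
    ∃ R' : Finset (ℕ × ℕ), R ⊆ R' ∧ IsPartialIso Y Z ↑R' ∧ ∃ b, (a, b) ∈ R' := by
  by_cases hdom : ∃ b, (a, b) ∈ R
  · exact ⟨R, subset_rfl, h, hdom⟩
  have hfresh : ∀ x ∈ R, x.1 ≠ a := fun x hx hxa => hdom ⟨x.2, hxa ▸ hx⟩
  let A : SComplex :=
    { faces := {s | ∃ t ⊆ R, t.Nonempty ∧ t.image Prod.snd = s ∧
        insert a (t.image Prod.fst) ∈ Y.faces}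
      nonempty_of_mem := by
        rintro _ ⟨t, -, ht, rfl, -⟩
        exact ht.image _
      down_closed := by
        rintro _ ⟨t, htR, ht, rfl, hta⟩ s hs hne
        obtain ⟨t', ht', rfl⟩ := Finset.subset_image_iff.1 hs
        exact ⟨t', (Finset.coe_subset.1 ht').trans htR, Finset.image_nonempty.1 hne, rfl,
          Y.down_closed _ hta _ (Finset.insert_subset_insert _ (Finset.image_subset_image ht'))
            (Finset.insert_nonempty _ _)⟩ }
  obtain ⟨v, ⟨hvZ, hvU⟩, hv⟩ := hZ (↑(R.image Prod.snd)) (Finset.finite_toSet _)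
    (by
      intro b hb
      obtain ⟨x, hx, rfl⟩ := Finset.mem_image.1 (Finset.mem_coe.1 hb)
      exact h.mem_right x hx) A
    (by
      rintro _ ⟨t, htR, ht, rfl, hta⟩
      refine ⟨(h.faces_iff t htR).1 (Y.down_closed _ hta _ (Finset.subset_insert _ _)
        (ht.image _)), ?_⟩
      exact_mod_cast Finset.image_subset_image htR)
  have hvfresh : ∀ x ∈ R, x.2 ≠ v := fun x hx hxv =>
    hvU (Finset.mem_coe.2 (Finset.mem_image.2 ⟨x, hx, hxv⟩))
  refine ⟨insert (a, v) R, Finset.subset_insert _ _, ⟨?_, ?_, ?_, ?_⟩, v, by simp⟩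
  · intro x hx
    rcases Finset.mem_insert.1 (Finset.mem_coe.1 hx) with rfl | hx
    exacts [ha, h.mem_left x hx]
  · intro x hx
    rcases Finset.mem_insert.1 (Finset.mem_coe.1 hx) with rfl | hx
    exacts [hvZ, h.mem_right x hx]
  · intro x hx y hy
    rcases Finset.mem_insert.1 (Finset.mem_coe.1 hx) with rfl | hx <;>
    rcases Finset.mem_insert.1 (Finset.mem_coe.1 hy) with rfl | hy
    · simp
    · simp [(hfresh y hy).symm, (hvfresh y hy).symm]
    · simp [hfresh x hx, hvfresh x hx]
    · exact h.eq_iff x hx y hy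
  · intro t ht
    have ht : t ⊆ insert (a, v) R := Finset.coe_subset.1 ht
    by_cases hat : (a, v) ∈ t
    · obtain ⟨t, hnot, rfl⟩ : ∃ t' : Finset (ℕ × ℕ), (a, v) ∉ t' ∧ insert (a, v) t' = t :=
        ⟨t.erase (a, v), by simp, Finset.insert_erase hat⟩
      have htR : t ⊆ R := (Finset.insert_subset_insert_iff hnot).1 (by
        refine ht.trans (Finset.insert_subset_insert _ subset_rfl))
      rw [Finset.image_insert, Finset.image_insert]
      rcases t.eq_empty_or_nonempty with rfl | hne
      · exact iff_of_true ha hvZ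
      have hsub : (↑(t.image Prod.snd) : Set ℕ) ⊆ ↑(R.image Prod.snd) := by
        exact_mod_cast Finset.image_subset_image htR
      constructor
      · intro hY
        have : t.image Prod.snd ∈ A.faces := ⟨t, htR, hne, rfl, hY⟩
        rw [← hv] at this
        exact this.1.2.2
      · intro hZ'
        have hface : t.image Prod.snd ∈ Z.faces :=
          Z.down_closed _ hZ' _ (Finset.subset_insert _ _) (hne.image _)
        have : t.image Prod.snd ∈ A.faces := by
          rw [← hv]
          exact ⟨⟨hface, fun hvt => hvU (hsub hvt), hZ'⟩, hface, hsub⟩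
        obtain ⟨t', ht'R, -, himg, hY⟩ := this
        have hinj : Set.InjOn Prod.snd (↑R : Set (ℕ × ℕ)) := fun x hx y hy hxy =>
          Prod.ext ((h.eq_iff x hx y hy).2 hxy) hxy
        have htt : t' = t := by
          have := congrArg (fun s : Finset ℕ => (↑s : Set ℕ)) himg
          simp only [Finset.coe_image] at this
          exact_mod_cast (hinj.image_eq_image_iff (Finset.coe_subset.2 ht'R)
            (Finset.coe_subset.2 htR)).1 this
        exact htt ▸ hY
    · exact h.faces_iff t ((Finset.subset_insert_iff_of_notMem hat).1 ht)

/-- The back step of the back-and-forth construction. -/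
lemma IsPartialIso.exists_extension_right {Y Z : SComplex} (hY : Y.AmpleProp)
    {R : Finset (ℕ × ℕ)} (h : IsPartialIso Y Z ↑R) {b : ℕ} (hb : b ∈ Z.vertexSet) :
    ∃ R' : Finset (ℕ × ℕ), R ⊆ R' ∧ IsPartialIso Y Z ↑R' ∧ ∃ a, (a, b) ∈ R' := by
  obtain ⟨R', hsub, hR', a, ha⟩ := h.swap.exists_extension hY hb
  refine ⟨R'.image Prod.swap, fun x hx => ?_, hR'.swap, a, Finset.mem_image.2 ⟨_, ha, rfl⟩⟩
  exact Finset.mem_image.2 ⟨x.swap, hsub (Finset.mem_image_of_mem _ hx), Prod.swap_swap x⟩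

/-- A finite partial isomorphism extends to a partial isomorphism meeting countably many
requirements, provided each requirement can be met by a finite extension of any given
finite partial isomorphism. -/
lemma IsPartialIso.exists_of_requirements {Y Z : SComplex} {ι : Type*} [Encodable ι]
    (D : ι → Set (ℕ × ℕ) → Prop) (hmono : ∀ i R R', R ⊆ R' → D i R → D i R')
    (hD : ∀ i (R : Finset (ℕ × ℕ)), IsPartialIso Y Z ↑R →
      ∃ R' : Finset (ℕ × ℕ), R ⊆ R' ∧ IsPartialIso Y Z ↑R' ∧ D i ↑R')
    {R₀ : Finset (ℕ × ℕ)} (h₀ : IsPartialIso Y Z ↑R₀) :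
    ∃ R : Set (ℕ × ℕ), ↑R₀ ⊆ R ∧ IsPartialIso Y Z R ∧ ∀ i, D i R := by
  let P := {R : Finset (ℕ × ℕ) // IsPartialIso Y Z ↑R}
  let 𝒟 : ι → Order.Cofinal P := fun i =>
    { carrier := {R | D i ↑R.1}
      isCofinal := fun R => by
        obtain ⟨R', hsub, hR', hi⟩ := hD i R.1 R.2
        exact ⟨⟨R', hR'⟩, hi, hsub⟩ }
  let p₀ : P := ⟨R₀, h₀⟩
  let I : Order.Ideal P := Order.idealOfCofinals p₀ 𝒟
  let R : Set (ℕ × ℕ) := {x | ∃ Q ∈ I, x ∈ Q.1}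
  have hle : ∀ Q ∈ I, (↑Q.1 : Set (ℕ × ℕ)) ⊆ R := fun Q hQ x hx => ⟨Q, hQ, hx⟩
  have hp₀ : p₀ ∈ I := Order.mem_idealOfCofinals p₀ 𝒟
  have hfin : ∀ t : Finset (ℕ × ℕ), (↑t : Set (ℕ × ℕ)) ⊆ R → ∃ Q ∈ I, t ⊆ Q.1 := by
    intro t
    induction t using Finset.induction_on with
    | empty => exact fun _ => ⟨p₀, hp₀, Finset.empty_subset _⟩
    | insert x t _ ih =>
      intro ht
      rw [Finset.coe_insert, Set.insert_subset_iff] at ht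
      obtain ⟨Q₁, hQ₁, hx⟩ := ht.1
      obtain ⟨Q₂, hQ₂, ht⟩ := ih ht.2
      obtain ⟨Q, hQ, h₁, h₂⟩ := I.directed Q₁ hQ₁ Q₂ hQ₂
      exact ⟨Q, hQ, Finset.insert_subset (h₁ hx) (ht.trans h₂)⟩
  refine ⟨R, hle p₀ hp₀, ⟨?_, ?_, ?_, ?_⟩, fun i => ?_⟩
  · rintro x ⟨Q, -, hx⟩
    exact Q.2.mem_left x hx
  · rintro x ⟨Q, -, hx⟩
    exact Q.2.mem_right x hx
  · intro x hx y hy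
    obtain ⟨Q, -, hQ⟩ := hfin {x, y} (by simp [Set.insert_subset_iff, hx, hy])
    exact Q.2.eq_iff x (hQ (by simp)) y (hQ (by simp))
  · intro t ht
    obtain ⟨Q, -, hQ⟩ := hfin t ht
    exact Q.2.faces_iff t hQ
  · obtain ⟨Q, hQD, hQ⟩ := Order.cofinal_meets_idealOfCofinals p₀ 𝒟 i
    exact hmono i _ _ (hle Q hQ) hQD

/-- A partial isomorphism defined on all vertices is an isomorphism onto an induced
subcomplex. -/
lemma IsPartialIso.exists_isIso_induced {Y Z : SComplex} {R : Set (ℕ × ℕ)}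
    (h : IsPartialIso Y Z R) (hdom : ∀ a ∈ Y.vertexSet, ∃ b, (a, b) ∈ R) :
    ∃ f : ℕ → ℕ, (∀ x ∈ R, f x.1 = x.2) ∧ f '' Y.vertexSet ⊆ Z.vertexSet ∧
      IsIso Y (Z.induced (f '' Y.vertexSet)) f := by
  choose! f hf using hdom
  have hsub : f '' Y.vertexSet ⊆ Z.vertexSet := by
    rintro _ ⟨a, ha, rfl⟩
    exact h.mem_right _ (hf a ha)
  refine ⟨f, fun x hx => (h.eq_iff _ (hf _ (h.mem_left x hx)) x hx).1 rfl, hsub, ?_, ?_⟩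
  · rw [vertexSet_induced, Set.inter_eq_right.2 hsub]
    exact Set.InjOn.bijOn_image fun a ha b hb hab =>
      (h.eq_iff _ (hf a ha) _ (hf b hb)).2 hab
  · intro s hs
    have := h.faces_iff (s.image fun a => (a, f a)) (by
      intro x hx
      obtain ⟨a, ha, rfl⟩ := Finset.mem_image.1 (Finset.mem_coe.1 hx)
      exact hf a (hs ha))
    simp only [Finset.image_image, Function.comp_def, Finset.image_id'] at this
    rw [this]
    refine ⟨fun hZ => ⟨hZ, ?_⟩, fun hZ => hZ.1⟩
    rw [Finset.coe_image]
    exact Set.image_mono hs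

lemma IsIso.isPartialIso_graph {X Y : SComplex} {U U' : Set ℕ} {f : ℕ → ℕ}
    (hf : IsIso (X.induced U) (Y.induced U') f) (hU : U ⊆ X.vertexSet) :
    IsPartialIso X Y ((fun a => (a, f a)) '' U) := by
  obtain ⟨hbij, hfaces⟩ := hf
  rw [vertexSet_induced, vertexSet_induced, Set.inter_eq_right.2 hU] at hbij
  rw [vertexSet_induced, Set.inter_eq_right.2 hU] at hfaces
  refine ⟨?_, ?_, ?_, ?_⟩
  · rintro _ ⟨a, ha, rfl⟩
    exact hU ha
  · rintro _ ⟨a, ha, rfl⟩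
    exact (hbij.mapsTo ha).1
  · rintro _ ⟨a, ha, rfl⟩ _ ⟨b, hb, rfl⟩
    exact (hbij.injOn.eq_iff ha hb).symm
  · intro t ht
    have hsub : (↑(t.image Prod.fst) : Set ℕ) ⊆ U := by
      intro a ha
      obtain ⟨x, hx, rfl⟩ := Finset.mem_image.1 (Finset.mem_coe.1 ha)
      obtain ⟨b, hb, rfl⟩ := ht hx
      exact hb
    have himg : (t.image Prod.fst).image f = t.image Prod.snd := by
      rw [Finset.image_image]
      refine Finset.image_congr fun x hx => ?_
      obtain ⟨b, -, rfl⟩ := ht hx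
      rfl
    have := hfaces _ hsub
    rw [himg] at this
    refine ⟨fun h => (this.1 ⟨h, hsub⟩).1, fun h => (this.2 ⟨h, ?_⟩).1⟩
    rw [← himg, Finset.coe_image]
    exact fun b hb => (hbij.mapsTo.image_subset.trans Set.inter_subset_right)
      (Set.image_mono hsub hb)

lemma AmpleProp.universal {X : SComplex} (hX : X.AmpleProp) : X.Universal := by
  intro Y _
  have hempty : IsPartialIso Y X ↑(∅ : Finset (ℕ × ℕ)) := by
    simpa using IsPartialIso.empty Y X
  obtain ⟨R, -, hR, hdom⟩ := hempty.exists_of_requirements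
    (fun (a : ℕ) R => a ∈ Y.vertexSet → ∃ b, (a, b) ∈ R)
    (fun a R R' hsub h ha => (h ha).imp fun b hb => hsub hb)
    (fun a R hR => by
      by_cases ha : a ∈ Y.vertexSet
      · obtain ⟨R', hsub, hR', hb⟩ := hR.exists_extension hX ha
        exact ⟨R', hsub, hR', fun _ => hb⟩
      · exact ⟨R, subset_rfl, hR, fun h => absurd h ha⟩)
  obtain ⟨f, -, hsub, hf⟩ := hR.exists_isIso_induced hdom
  exact ⟨_, hsub, f, hf⟩

lemma AmpleProp.homogeneous {X : SComplex} (hX : X.AmpleProp) : X.Homogeneous := by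
  intro U U' hU _ hUX _ f hf
  have hgraph := hf.isPartialIso_graph hUX
  rw [← (hU.image _).coe_toFinset] at hgraph
  obtain ⟨R, hsub, hR, hdom⟩ := hgraph.exists_of_requirements
    (fun (i : ℕ ⊕ ℕ) R => i.elim (fun a => a ∈ X.vertexSet → ∃ b, (a, b) ∈ R)
      (fun b => b ∈ X.vertexSet → ∃ a, (a, b) ∈ R))
    (by
      rintro (a | b) R R' hsub h ha
      · exact (h ha).imp fun b hb => hsub hb
      · exact (h ha).imp fun a ha => hsub ha)
    (by
      rintro (a | a) R hR <;> by_cases ha : a ∈ X.vertexSet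
      · obtain ⟨R', hsub, hR', hb⟩ := hR.exists_extension hX ha
        exact ⟨R', hsub, hR', fun _ => hb⟩
      · exact ⟨R, subset_rfl, hR, fun h => absurd h ha⟩
      · obtain ⟨R', hsub, hR', hb⟩ := hR.exists_extension_right hX ha
        exact ⟨R', hsub, hR', fun _ => hb⟩
      · exact ⟨R, subset_rfl, hR, fun h => absurd h ha⟩)
  obtain ⟨F, hFR, hFsub, hFbij, hFfaces⟩ := hR.exists_isIso_induced fun a => hdom (.inl a)
  have himg : F '' X.vertexSet = X.vertexSet := by
    refine hFsub.antisymm fun b hb => ?_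
    obtain ⟨a, ha⟩ := hdom (.inr b) hb
    exact ⟨a, hR.mem_left _ ha, hFR _ ha⟩
  rw [himg] at hFbij hFfaces
  rw [vertexSet_induced, Set.inter_self] at hFbij
  refine ⟨F, ⟨hFbij, fun s hs => (hFfaces s hs).trans ⟨fun h => h.1, fun h => ⟨h, ?_⟩⟩⟩, ?_⟩
  · exact fun v hv => mem_vertexSet_of_mem_face h hv
  · intro a ha
    refine hFR (a, f a) (hsub ?_)
    rw [Set.Finite.coe_toFinset]
    exact ⟨a, ha, rfl⟩

lemma AmpleProp.isRado {X : SComplex} (hX : X.AmpleProp) : X.IsRado :=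
  ⟨Set.to_countable _, hX.universal, hX.homogeneous⟩

lemma IsRado.ampleProp {X : SComplex} (hX : X.IsRado) : X.AmpleProp := by
  obtain ⟨-, huniv, hhom⟩ := hX
  intro U hU hUX A hA
  obtain ⟨w, hw⟩ := hU.exists_notMem
  have hAw : ∀ s ∈ A.faces, w ∉ s := fun s hs hws => hw ((hA hs).2 hws)
  let Y : SComplex :=
    { faces := {s | s ∈ (X.induced U).faces ∨ w ∈ s ∧ (s.erase w = ∅ ∨ s.erase w ∈ A.faces)}
      nonempty_of_mem := by
        rintro s (hs | ⟨hs, -⟩)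
        exacts [(X.induced U).nonempty_of_mem s hs, ⟨w, hs⟩]
      down_closed := by
        rintro s (hs | ⟨hws, hs⟩) t hts ht
        · exact .inl ((X.induced U).down_closed s hs t hts ht)
        have hsub : t.erase w ⊆ s.erase w := Finset.erase_subset_erase w hts
        have key : t.erase w = ∅ ∨ t.erase w ∈ A.faces := by
          rcases (t.erase w).eq_empty_or_nonempty with h | h
          · exact .inl h
          rcases hs with hs | hs
          · exact .inl (Finset.subset_empty.1 (hs ▸ hsub))
          · exact .inr (A.down_closed _ hs _ hsub h)
        by_cases hwt : w ∈ t
        · exact .inr ⟨hwt, key⟩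
        · rw [Finset.erase_eq_of_notMem hwt] at key
          exact .inl (hA (key.resolve_left ht.ne_empty)) }
  have hYU : ∀ s : Finset ℕ, (↑s : Set ℕ) ⊆ U → (s ∈ Y.faces ↔ s ∈ X.faces) := fun s hs =>
    ⟨fun h => h.elim (fun h => h.1) fun h => absurd (hs h.1) hw, fun h => .inl ⟨h, hs⟩⟩
  have hYw : w ∈ Y.vertexSet := .inr ⟨by simp, .inl (by simp)⟩
  have hUY : U ⊆ Y.vertexSet := fun u hu => (hYU {u} (by simpa using hu)).2 (hUX hu)
  obtain ⟨W, hWX, g, hbij, hfaces⟩ := huniv Y (Set.to_countable _)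
  rw [vertexSet_induced, Set.inter_eq_right.2 hWX] at hbij
  have hg : ∀ s : Finset ℕ, (↑s : Set ℕ) ⊆ Y.vertexSet →
      (s ∈ Y.faces ↔ s.image g ∈ X.faces) := fun s hs =>
    (hfaces s hs).trans ⟨fun h => h.1, fun h => ⟨h, by
      rw [Finset.coe_image]
      exact (Set.image_mono hs).trans hbij.mapsTo.image_subset⟩⟩
  have hgUX : g '' U ⊆ X.vertexSet :=
    ((Set.image_mono hUY).trans hbij.mapsTo.image_subset).trans hWX
  obtain ⟨F, ⟨hFbij, hF⟩, hFg⟩ := hhom U (g '' U) hU (hU.image g) hUX hgUX g (by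
    refine ⟨?_, fun s hs => ?_⟩
    · rw [vertexSet_induced, vertexSet_induced, Set.inter_eq_right.2 hUX,
        Set.inter_eq_right.2 hgUX]
      exact (hbij.injOn.mono hUY).bijOn_image
    · rw [vertexSet_induced, Set.inter_eq_right.2 hUX] at hs
      have hiff := (hYU s hs).symm.trans (hg s (hs.trans hUY))
      refine ⟨fun h => ⟨hiff.1 h.1, ?_⟩, fun h => ⟨hiff.2 h.1, hs⟩⟩
      rw [Finset.coe_image]
      exact Set.image_mono hs)
  obtain ⟨v, hvX, hv⟩ := hFbij.surjOn (hWX (hbij.mapsTo hYw))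
  have hvU : v ∉ U := by
    intro hvU
    have : g v = g w := (hFg hvU).symm.trans hv
    exact hw (hbij.injOn (hUY hvU) hYw this ▸ hvU)
  have hlink : ∀ s : Finset ℕ, s.Nonempty → (↑s : Set ℕ) ⊆ U →
      (insert v s ∈ X.faces ↔ s ∈ A.faces) := by
    intro s hne hs
    have hws : w ∉ s := fun h => hw (hs h)
    have himg : (insert v s).image F = (insert w s).image g := by
      rw [Finset.image_insert, Finset.image_insert, hv,
        Finset.image_congr (g := g) (fun a ha => hFg (hs ha))]
    rw [hF _ (by
        rw [Finset.coe_insert]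
        exact Set.insert_subset hvX (hs.trans hUX)), himg,
      ← hg _ (by
        rw [Finset.coe_insert]
        exact Set.insert_subset hYw (hs.trans hUY))]
    constructor
    · rintro (h | ⟨-, h⟩)
      · exact absurd (h.2 (Finset.mem_coe.2 (Finset.mem_insert_self w s))) hw
      · rw [Finset.erase_insert hws] at h
        exact h.resolve_left hne.ne_empty
    · intro h
      refine .inr ⟨Finset.mem_insert_self w s, .inr ?_⟩
      rwa [Finset.erase_insert hws]
  refine ⟨v, ⟨hvX, hvU⟩, Set.ext fun s => ⟨?_, fun hs => ?_⟩⟩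
  · rintro ⟨⟨hsX, -, hins⟩, -, hsU⟩
    exact (hlink s (X.nonempty_of_mem s hsX) hsU).1 hins
  · have hsU := (hA hs).2
    exact ⟨⟨(hA hs).1, fun h => hvU (hsU h),
      (hlink s (A.nonempty_of_mem s hs) hsU).2 hs⟩, hA hs⟩

lemma AmpleProp.induced_of_finite_diff {X : SComplex} (hX : X.AmpleProp) {S : Set ℕ}
    (hS : (X.vertexSet \ S).Finite) : (X.induced S).AmpleProp := by
  intro U hU hUS A hA
  rw [vertexSet_induced] at hUS ⊢
  have hA' : ∀ s ∈ A.faces, s ∈ X.faces ∧ (↑s : Set ℕ) ⊆ U := fun s hs =>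
    ⟨(hA hs).1.1, (hA hs).2⟩
  obtain ⟨v, ⟨hvX, hvU⟩, hv⟩ := hX (U ∪ X.vertexSet \ S) (hU.union hS)
    (Set.union_subset (hUS.trans Set.inter_subset_left) Set.sdiff_subset) A
    fun s hs => ⟨(hA' s hs).1, (hA' s hs).2.trans Set.subset_union_left⟩
  have hvS : v ∈ S := by_contra fun h => hvU (.inr ⟨hvX, h⟩)
  refine ⟨v, ⟨⟨hvX, hvS⟩, fun h => hvU (.inl h)⟩, Set.ext fun s => ⟨?_, fun hs => ?_⟩⟩
  · rintro ⟨⟨hsX, hvs, hins⟩, -, hsU⟩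
    rw [← hv]
    exact ⟨⟨hsX.1, hvs, hins.1⟩, hsX.1, hsU.trans Set.subset_union_left⟩
  · have hsl : s ∈ (X.link v).faces := (hv.symm ▸ hs : s ∈ (X.link v).faces ∩ _).1
    refine ⟨⟨(hA hs).1, hsl.2.1, hsl.2.2, ?_⟩, hA hs⟩
    rw [Finset.coe_insert]
    exact Set.insert_subset hvS (hA hs).1.2

end SComplex

lemma IsBernoulli.ae_finite_compl_selected {μ : MeasureTheory.Measure (ℕ → Bool)} {p : ℕ → ℝ}
    (hμ : IsBernoulli μ p) (hp : ∀ n, p n ≤ 1) (hsum : Summable fun n => 1 - p n) :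
    ∀ᵐ ω ∂μ, (selected ω)ᶜ.Finite := by
  have hmeas : ∀ n, μ {ω | ω n = false} = ENNReal.ofReal (1 - p n) := fun n => by
    simpa using hμ.2 {n} fun _ => false
  have htsum : ∑' n, μ {ω | ω n = false} ≠ ⊤ := by
    simp_rw [hmeas]
    rw [← ENNReal.ofReal_tsum_of_nonneg (fun n => sub_nonneg.2 (hp n)) hsum]
    exact ENNReal.ofReal_ne_top
  filter_upwards [MeasureTheory.ae_finite_setOfPred_mem htsum] with ω hω
  simpa [selected, Set.compl_ofPred] using hω

/-- Let `X` be a Rado complex with vertex set all of `ℕ` and select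
each vertex `n` independently with probability `p n`.  If `∑ (1 - p n) < ∞`, then almost
surely the set of selected vertices has finite complement in `ℕ` and the subcomplex
induced on it is a Rado complex. -/
theorem random_induced_subcomplex_rado_of_summable (X : SComplex) (hX : X.IsRado)
    (hV : X.vertexSet = Set.univ)
    (p : ℕ → ℝ) (hp : ∀ n, p n ∈ Set.Icc (0 : ℝ) 1)
    (hsum : Summable fun n => 1 - p n)
    (μ : MeasureTheory.Measure (ℕ → Bool)) (hμ : IsBernoulli μ p) :
    μ {ω | (selected ω)ᶜ.Finite ∧ (X.induced (selected ω)).IsRado} = 1 := by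
  have := hμ.1
  have hae : ∀ᵐ ω ∂μ, (selected ω)ᶜ.Finite ∧ (X.induced (selected ω)).IsRado := by
    filter_upwards [hμ.ae_finite_compl_selected (fun n => (hp n).2) hsum] with ω hω
    refine ⟨hω, (hX.ampleProp.induced_of_finite_diff ?_).isRado⟩
    exact hω.subset fun n hn => hn.2
  rw [MeasureTheory.measure_eq_measure_of_null_sdiff (Set.subset_univ _) ?_,
    MeasureTheory.measure_univ]
  rwa [← Set.compl_eq_univ_sdiff]
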